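/- Let n ≥ 1 be an integer and t > 0. The function h_n(z) := (z−1)^n (1+ξ_{2t}(z))^{2n} / (4^n ξ_{2t}(z)^n) has a removable singularity at z = 1, and its Taylor expansion at z = 1 is h_n(z) = Σ_{m≥0} [ Σ_{k=0}^{min(m,2n)} binom(2n,k) e^{(k−n)t} L_{m−k}^{(n−m)}(2(n−k)t) ] · (z−1)^m / 2^{n+m}. -/

import Mathlib

open scoped BigOperators

/-- Pochhammer symbol `(a)_k = a(a+1)⋯(a+k-1)` over ℝ. -/
noncomputable def pochR (a : ℝ) (k : ℕ) : ℝ := ∏ i ∈ Finset.range k, (a + i)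

/-- Generalized Laguerre polynomial `L_n^{(α)}(x)`. -/
noncomputable def Lag (n : ℕ) (α : ℝ) (x : ℝ) : ℝ :=
  (1 / (n.factorial : ℝ)) * ∑ j ∈ Finset.range (n + 1),
    (pochR (-(n : ℝ)) j / (j.factorial : ℝ)) * pochR (α + j + 1) (n - j) * x ^ j

/-- The polynomials `P_n^{(m)}(ε) = ((-1)^m/m!) Σ_{k=0}^n C(n,k) (-ε)^k (2k)_m`. -/
noncomputable def Ppoly (n m : ℕ) (ε : ℝ) : ℝ :=
  ((-1 : ℝ) ^ m / (m.factorial : ℝ)) * ∑ k ∈ Finset.range (n + 1),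
    (n.choose k : ℝ) * (-ε) ^ k * pochR (2 * k) m

/-- The Taylor coefficients `a_n(κ,t)`. -/
noncomputable def acoef (κ t : ℝ) (n : ℕ) : ℝ :=
  (2 / (4 ^ n * n)) * ∑ k ∈ Finset.Icc 1 n,
    ((2 * n).choose (n - k) : ℝ) * Real.exp (-(k : ℝ) * t) *
      ∑ m ∈ Finset.range k, Lag (k - m - 1) ((m : ℝ) + 1) (2 * k * t) * 2 ^ m * Ppoly n m (κ ^ 2)

/-- `ξ_{2t}(z) = ((z-1)/(z+1)) e^{tz}`. -/
noncomputable def xiF (t : ℝ) (z : ℂ) : ℂ := ((z - 1) / (z + 1)) * Complex.exp (t * z)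


lemma hasSum_congr_fun {f g : ℕ → ℂ} {s : ℂ} (h : ∀ j, f j = g j) :
    HasSum f s ↔ HasSum g s := by
  rw [funext h]

lemma pochR_neg_aux (j i : ℕ) (h : i ≤ j) :
    pochR (-(j : ℝ)) i * ((j - i).factorial : ℝ) = (-1) ^ i * (j.factorial : ℝ) := by
  induction i with
  | zero => simp [pochR]
  | succ i ih =>
    have ih' := ih (by omega)
    have e : j - i = (j - (i + 1)) + 1 := by omega
    have hc : ((j - (i + 1) : ℕ) : ℝ) = (j : ℝ) - (i + 1) := by
      rw [Nat.cast_sub h]; push_cast; ring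
    rw [e, Nat.factorial_succ] at ih'
    push_cast at ih'
    rw [hc] at ih'
    have : pochR (-(j : ℝ)) (i + 1) = pochR (-(j : ℝ)) i * (-(j : ℝ) + i) := by
      simp [pochR, Finset.prod_range_succ]
    rw [this, pow_succ]
    linear_combination (-1) * ih'

lemma pochR_reflect (a : ℝ) (d : ℕ) :
    pochR (a - d + 1) d = ∏ l ∈ Finset.range d, (a - l) := by
  unfold pochR
  rw [← Finset.prod_range_reflect]
  apply Finset.prod_congr rfl
  intro l hl
  have hl' : l + 1 ≤ d := Finset.mem_range.mp hl
  have : ((d - 1 - l : ℕ) : ℝ) = (d : ℝ) - 1 - l := by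
    rw [Nat.cast_sub (by omega), Nat.cast_sub (by omega)]; simp
  rw [this]; ring

lemma Lag_eq (a x : ℝ) (j : ℕ) :
    Lag j (a - j) x = ∑ i ∈ Finset.range (j + 1),
      ((-x) ^ i / (i.factorial : ℝ)) *
        ((∏ l ∈ Finset.range (j - i), (a - l)) / ((j - i).factorial : ℝ)) := by
  unfold Lag
  rw [Finset.mul_sum]
  apply Finset.sum_congr rfl
  intro i hi
  have hi' : i ≤ j := by have := Finset.mem_range.mp hi; omega
  have h1 := pochR_neg_aux j i hi'
  have h2 : a - (j : ℝ) + i + 1 = a - ((j - i : ℕ) : ℝ) + 1 := by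
    rw [Nat.cast_sub hi']; ring
  rw [h2, pochR_reflect]
  have f1 : (j.factorial : ℝ) ≠ 0 := by positivity
  have f2 : (i.factorial : ℝ) ≠ 0 := by positivity
  have f3 : ((j - i).factorial : ℝ) ≠ 0 := by positivity
  have h3 : pochR (-(j : ℝ)) i = (-1) ^ i * (j.factorial : ℝ) / ((j - i).factorial : ℝ) := by
    rw [eq_div_iff f3, h1]
  rw [h3, neg_pow x]
  field_simp

lemma smeval_desc (a : ℂ) (j : ℕ) :
    (descPochhammer ℤ j).smeval a = ∏ l ∈ Finset.range j, (a - l) := by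
  induction j with
  | zero => simp
  | succ j ih =>
    rw [descPochhammer_succ_right, Polynomial.smeval_mul, ih, Finset.prod_range_succ]
    simp [Polynomial.smeval_sub, Polynomial.smeval_natCast]

lemma hasSum_binom (a : ℤ) (u : ℂ) (hu : ‖u‖ < 1) :
    HasSum (fun j : ℕ => (((∏ l ∈ Finset.range j, ((a : ℝ) - l)) / (j.factorial : ℝ) : ℝ) : ℂ)
      * u ^ j) ((1 + u) ^ a) := by
  have h := (Complex.one_add_cpow_hasFPowerSeriesOnBall_zero (a := (a : ℂ))).hasSum
    (y := u) (by simpa [Metric.mem_eball, edist_zero_right, enorm_eq_nnnorm, ← NNReal.coe_lt_one] using hu)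
  simp only [zero_add, Complex.cpow_intCast] at h
  refine (hasSum_congr_fun fun j => ?_).mpr h
  rw [binomialSeries_apply, Ring.choose_eq_smul, smeval_desc]
  simp
  left
  ring

lemma hasSum_Lag (a : ℤ) (x : ℝ) (u : ℂ) (hu : ‖u‖ < 1) :
    HasSum (fun j : ℕ => ((Lag j ((a : ℝ) - j) x : ℝ) : ℂ) * u ^ j)
      (Complex.exp (-x * u) * (1 + u) ^ a) := by
  have hb := hasSum_binom a u hu
  have he : HasSum (fun i : ℕ => (((-x) ^ i / (i.factorial : ℝ) : ℝ) : ℂ) * u ^ i)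
      (Complex.exp (-x * u)) := by
    have := NormedSpace.expSeries_div_hasSum_exp (-x * u : ℂ)
    rw [← Complex.exp_eq_exp_ℂ] at this
    refine (hasSum_congr_fun fun i => ?_).mpr this
    push_cast
    rw [mul_pow]; ring
  have h := hasSum_sum_range_mul_of_summable_norm he.summable.norm hb.summable.norm
  rw [he.tsum_eq, hb.tsum_eq] at h
  refine (hasSum_congr_fun fun j => ?_).mpr h
  rw [Lag_eq]
  push_cast
  rw [Finset.sum_mul]
  apply Finset.sum_congr rfl
  intro i hi
  have hi' : i ≤ j := by have := Finset.mem_range.mp hi; omega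
  have : u ^ j = u ^ i * u ^ (j - i) := by rw [← pow_add]; congr 1; omega
  rw [this]; ring

lemma hasSum_shift (f : ℕ → ℂ) (s : ℂ) (k : ℕ) (h : HasSum f s) :
    HasSum (fun m => if k ≤ m then f (m - k) else 0) s := by
  have hinj : Function.Injective (fun j : ℕ => j + k) := add_left_injective k
  rw [← hinj.hasSum_iff]
  · refine (hasSum_congr_fun fun j => ?_).mpr h
    simp
  · intro m hm
    rw [if_neg]
    intro hk
    exact hm ⟨m - k, by simp; omega⟩

/-- The `k`-th summand of the extension of `h_n`. -/
noncomputable def gTerm (n : ℕ) (t : ℝ) (k : ℕ) (z : ℂ) : ℂ :=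
  ((2 * n).choose k : ℂ) * (z - 1) ^ k * (z + 1) ^ ((n : ℤ) - k) *
    Complex.exp (((k : ℂ) - n) * t * z) / 4 ^ n

lemma gTerm_hasSum (n : ℕ) (t : ℝ) (k : ℕ) (z : ℂ) (hz : ‖z - 1‖ < 2) :
    HasSum (fun m : ℕ => if k ≤ m then ((((2 * n).choose k : ℝ) *
            Real.exp (((k : ℝ) - n) * t) *
            Lag (m - k) ((n : ℝ) - m) (2 * ((n : ℝ) - k) * t) : ℝ) : ℂ) *
            (z - 1) ^ m / 2 ^ (n + m) else 0) (gTerm n t k z) := by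
  have hu : ‖(z - 1) / 2‖ < 1 := by
    rw [norm_div]; simp; linarith
  have h := hasSum_shift _ _ k ((hasSum_Lag ((n : ℤ) - k) (2 * ((n : ℝ) - k) * t) _ hu).mul_left
    ((((2 * n).choose k : ℝ) * Real.exp (((k : ℝ) - n) * t) : ℝ) * (z - 1) ^ k / 2 ^ (n + k) : ℂ))
  convert h using 1
  · funext m
    split_ifs with hk
    · obtain ⟨d, rfl⟩ := Nat.exists_eq_add_of_le hk
      have e : (((n : ℤ) - k : ℤ) : ℝ) - ((d : ℕ) : ℝ) = (n : ℝ) - ((k + d : ℕ) : ℝ) := by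
        push_cast; ring
      rw [Nat.add_sub_cancel_left, e]
      push_cast
      rw [div_pow, pow_add, pow_add, pow_add, pow_add]
      field_simp
    · rfl
  · unfold gTerm
    have e1 : (1 + (z - 1) / 2 : ℂ) = (z + 1) / 2 := by ring
    rw [e1, div_zpow]
    have e2 : Complex.exp (((k : ℂ) - n) * t * z) = Complex.exp (((k : ℂ) - n) * t) *
        Complex.exp (-((2 * ((n : ℝ) - k) * t : ℝ) : ℂ) * ((z - 1) / 2)) := by
      rw [← Complex.exp_add]; congr 1; push_cast; ring
    rw [e2]
    have e3 : (2 : ℂ) ^ ((n : ℤ) - k) = 2 ^ n / 2 ^ k := by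
      rw [zpow_sub₀ two_ne_zero]; simp
    have e4 : (4 : ℂ) ^ n = 2 ^ n * 2 ^ n := by rw [← mul_pow]; norm_num
    rw [e3, e4, pow_add]
    push_cast
    field_simp

lemma gTerm_sum (n : ℕ) (t : ℝ) (z : ℂ) (h1 : z - 1 ≠ 0) (h2 : z + 1 ≠ 0) :
    ∑ k ∈ Finset.range (2 * n + 1), gTerm n t k z =
      (z - 1) ^ n * (1 + xiF t z) ^ (2 * n) / (4 ^ n * (xiF t z) ^ n) := by
  rw [add_comm 1, add_pow, Finset.mul_sum, Finset.sum_div]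
  apply Finset.sum_congr rfl
  intro k _
  unfold gTerm xiF
  have e2 : Complex.exp (((k : ℂ) - n) * t * z) =
      Complex.exp (t * z) ^ k / Complex.exp (t * z) ^ n := by
    rw [← Complex.exp_nat_mul, ← Complex.exp_nat_mul, ← Complex.exp_sub]; congr 1; ring
  have e3 : (z + 1) ^ ((n : ℤ) - k) = (z + 1) ^ n / (z + 1) ^ k := by
    rw [zpow_sub₀ h2]; simp
  have h3 := Complex.exp_ne_zero (t * z)
  rw [e2, e3, mul_pow, mul_pow, div_pow, div_pow]
  simp only [one_pow, mul_one]
  field_simp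

theorem stmt10 (n : ℕ) (hn : 1 ≤ n) (t : ℝ) (ht : 0 < t) :
    ∃ g : ℂ → ℂ, AnalyticAt ℂ g 1 ∧
      (∀ᶠ z in nhdsWithin (1 : ℂ) {(1 : ℂ)}ᶜ,
        g z = (z - 1) ^ n * (1 + xiF t z) ^ (2 * n) / (4 ^ n * (xiF t z) ^ n)) ∧
      (∀ᶠ z in nhds (1 : ℂ),
        HasSum (fun m : ℕ =>
          (((∑ k ∈ Finset.range (min m (2 * n) + 1), ((2 * n).choose k : ℝ) *
            Real.exp (((k : ℝ) - n) * t) *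
            Lag (m - k) ((n : ℝ) - m) (2 * ((n : ℝ) - k) * t)) : ℝ) : ℂ) *
            (z - 1) ^ m / 2 ^ (n + m)) (g z)) := by
  have hball : ∀ᶠ z in nhds (1 : ℂ), ‖z - 1‖ < 2 := by
    filter_upwards [Metric.ball_mem_nhds (1 : ℂ) two_pos] with z hz
    simpa [dist_eq_norm] using hz
  have hne : ∀ z : ℂ, ‖z - 1‖ < 2 → z + 1 ≠ 0 := by
    intro z hz h0
    have : z - 1 = -2 := by linear_combination h0
    rw [this] at hz
    norm_num at hz
  refine ⟨fun z => ∑ k ∈ Finset.range (2 * n + 1), gTerm n t k z, ?_, ?_, ?_⟩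
  · apply Finset.analyticAt_fun_sum
    intro k _
    unfold gTerm
    have hz : AnalyticAt ℂ (fun z : ℂ => (z + 1) ^ ((n : ℤ) - k)) 1 :=
      (analyticAt_id.add analyticAt_const).zpow (by norm_num)
    have he : AnalyticAt ℂ (fun z : ℂ => Complex.exp (((k : ℂ) - n) * t * z)) 1 :=
      (analyticAt_const.mul analyticAt_id).cexp
    have hp : AnalyticAt ℂ (fun z : ℂ => (z - 1) ^ k) 1 :=
      (analyticAt_id.sub analyticAt_const).pow k
    exact (((analyticAt_const.mul hp).mul hz).mul he).div analyticAt_const (pow_ne_zero _ (by norm_num))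
  · filter_upwards [self_mem_nhdsWithin, nhdsWithin_le_nhds hball] with z hz hz2
    exact gTerm_sum n t z (sub_ne_zero.mpr hz) (hne z hz2)
  · filter_upwards [hball] with z hz
    have h := hasSum_sum (s := Finset.range (2 * n + 1))
      (fun k _ => gTerm_hasSum n t k z hz)
    convert h using 2 with m
    rw [← Finset.sum_filter]
    have : Finset.filter (fun k => k ≤ m) (Finset.range (2 * n + 1)) =
        Finset.range (min m (2 * n) + 1) := by
      ext k; simp only [Finset.mem_filter, Finset.mem_range]; omega
    rw [this, Complex.ofReal_sum, Finset.sum_mul, Finset.sum_div]
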